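/- Let p be an odd prime and n ≥ 3, and take q = p (so h = 1). Every integral automorphism γ of 𝔽_p^n is an affine transformation: there exist an invertible 𝔽_p-linear map L : 𝔽_p^n → 𝔽_p^n and b ∈ 𝔽_p^n such that γ(x) = L(x) + b for all x ∈ 𝔽_p^n. -/

import Mathlib

section NonsquareIndicator

variable {F : Type*} [Field F]

open Classical in
/-- The indicator function of the nonsquares of `F`, with values in `F`. -/
noncomputable def nonsquareInd (c : F) : F := if IsSquare c then 0 else 1

theorem nonsquareInd_congr {a b : F} (h : IsSquare a ↔ IsSquare b) :
    nonsquareInd a = nonsquareInd b := by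
  rw [nonsquareInd, nonsquareInd, propext h]

theorem ringChar_ne_two (h2 : (2 : F) ≠ 0) : ringChar F ≠ 2 := fun h => h2 (by
  have := ringChar.Nat.cast_ringChar (R := F)
  rw [h] at this
  exact_mod_cast this)

variable [Fintype F]

theorem sum_nonsquareInd_ne_zero (h2 : (2 : F) ≠ 0) : ∑ c : F, nonsquareInd c ≠ 0 := by
  classical
  have hchar := ringChar_ne_two h2
  have hterm : ∀ c : F, ((quadraticChar F c : ℤ) : F) =
      1 - 2 * nonsquareInd c - (if c = 0 then 1 else 0) := by
    intro c
    rw [quadraticChar_apply, quadraticCharFun, nonsquareInd]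
    split_ifs with h1 h2 <;> simp_all
    norm_num
  have hsum := congrArg (Int.cast (R := F)) (quadraticChar_sum_zero hchar)
  rw [Int.cast_sum, Finset.sum_congr rfl fun c _ => hterm c] at hsum
  intro h0
  simp [Finset.sum_sub_distrib, ← Finset.mul_sum, h0] at hsum

theorem sum_affine {M : Type*} [AddCommMonoid M] (f : F → M) (a : F) {b : F} (hb : b ≠ 0) :
    ∑ u : F, f (a + u * b) = ∑ c, f c :=
  Fintype.sum_equiv ((Equiv.mulRight₀ b hb).trans (Equiv.addLeft a)) _ _ fun _ => by simp

theorem sum_const_eq_zero (c : F) : ∑ _u : F, c = 0 := by simp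

end NonsquareIndicator

section Reciprocity

variable {F ι : Type*} [Field F] [Fintype F] [Fintype ι]

open scoped Classical in
theorem sum_nonsquareInd_line (h2 : (2 : F) ≠ 0) {m : ι → F} (hm : m ⬝ᵥ m = 0) (z : ι → F) :
    ∑ t : F, nonsquareInd ((z - t • m) ⬝ᵥ (z - t • m)) =
      (∑ c : F, nonsquareInd c) * (1 - if m ⬝ᵥ z = 0 then 1 else 0) := by
  have key : ∀ t : F, (z - t • m) ⬝ᵥ (z - t • m) = z ⬝ᵥ z + t * (-2 * (m ⬝ᵥ z)) := by
    intro t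
    simp only [sub_dotProduct, dotProduct_sub, smul_dotProduct, dotProduct_smul, hm,
      dotProduct_comm z m, smul_eq_mul]
    ring
  simp only [key]
  split_ifs with h
  · simp [h]
  · rw [sum_affine _ _ (mul_ne_zero (neg_ne_zero.2 h2) h)]
    ring

/-- A permutation preserving and reflecting the relation that the distance is a square. -/
def IsIntegralPerm (γ : (ι → F) ≃ (ι → F)) : Prop :=
  ∀ x y, IsSquare ((x - y) ⬝ᵥ (x - y)) ↔ IsSquare ((γ x - γ y) ⬝ᵥ (γ x - γ y))

open scoped Classical in
theorem IsIntegralPerm.sum_line_eq (h2 : (2 : F) ≠ 0) {γ : (ι → F) ≃ (ι → F)}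
    (hγ : IsIntegralPerm γ) {d m : ι → F} (hd : d ⬝ᵥ d = 0) (hm : m ⬝ᵥ m = 0) (x y : ι → F) :
    ∑ u : F, (if m ⬝ᵥ γ (x + u • d) = m ⬝ᵥ y then (1 : F) else 0) =
      ∑ t : F, (if d ⬝ᵥ γ.symm (y + t • m) = d ⬝ᵥ x then 1 else 0) := by
  have h1 : ∀ u t : F,
      nonsquareInd ((γ (x + u • d) - y - t • m) ⬝ᵥ (γ (x + u • d) - y - t • m)) =
      nonsquareInd ((γ.symm (y + t • m) - x - u • d) ⬝ᵥ (γ.symm (y + t • m) - x - u • d)) := by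
    intro u t
    apply nonsquareInd_congr
    have := hγ (γ.symm (y + t • m)) (x + u • d)
    rw [γ.apply_symm_apply] at this
    rw [sub_sub, sub_sub, this, ← neg_sub (y + t • m), neg_dotProduct_neg]
  have h3 : ∑ u : F, (∑ c : F, nonsquareInd c) *
        (1 - if m ⬝ᵥ (γ (x + u • d) - y) = 0 then 1 else 0) =
      ∑ t : F, (∑ c : F, nonsquareInd c) *
        (1 - if d ⬝ᵥ (γ.symm (y + t • m) - x) = 0 then 1 else 0) := by
    simp only [← sum_nonsquareInd_line h2 hm, ← sum_nonsquareInd_line h2 hd, h1]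
    exact Finset.sum_comm
  rw [← Finset.mul_sum, ← Finset.mul_sum] at h3
  have h4 := mul_left_cancel₀ (sum_nonsquareInd_ne_zero h2) h3
  simp only [Finset.sum_sub_distrib, sum_const_eq_zero, zero_sub, neg_inj, dotProduct_sub,
    sub_eq_zero] at h4
  exact h4

open scoped Classical in
theorem IsIntegralPerm.sum_line_congr (h2 : (2 : F) ≠ 0) {γ : (ι → F) ≃ (ι → F)}
    (hγ : IsIntegralPerm γ) {d m : ι → F} (hd : d ⬝ᵥ d = 0) (hm : m ⬝ᵥ m = 0) {x x' : ι → F}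
    (h : d ⬝ᵥ x = d ⬝ᵥ x') (c : F) :
    ∑ u : F, (if m ⬝ᵥ γ (x + u • d) = c then (1 : F) else 0) =
      ∑ u : F, (if m ⬝ᵥ γ (x' + u • d) = c then (1 : F) else 0) := by
  rcases eq_or_ne m 0 with rfl | hm0
  · simp
  · obtain ⟨y, rfl⟩ : ∃ y, m ⬝ᵥ y = c := by
      obtain ⟨w, hw⟩ : ∃ w, m ⬝ᵥ w ≠ 0 := by
        by_contra! hall
        exact hm0 ((dotProduct_eq_zero_iff).1 hall)
      exact ⟨(c / (m ⬝ᵥ w)) • w, by rw [dotProduct_smul, smul_eq_mul, div_mul_cancel₀ _ hw]⟩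
    rw [hγ.sum_line_eq h2 hd hm, hγ.sum_line_eq h2 hd hm, h]

end Reciprocity

section Plane

variable {F : Type*} [Field F]

/-- `h` is constant on all lines of the plane with direction `D`. -/
def InvariantAlong {α : Type*} (h : F × F → α) (D : F × F) : Prop :=
  ∀ (P : F × F) (u : F), h (P + u • D) = h P

theorem InvariantAlong.smul {α : Type*} {h : F × F → α} {D : F × F} (hD : InvariantAlong h D)
    (c : F) : InvariantAlong h (c • D) := fun P u => by rw [smul_smul, hD]

theorem exists_eq_smul_add_smul_of_not_invariantAlong {α : Type*} {h : F × F → α} {D E : F × F}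
    (hE : InvariantAlong h E) (hE0 : E ≠ 0) (hD : ¬ InvariantAlong h D) (P : F × F) :
    ∃ a b : F, P = a • D + b • E := by
  have hdet : D.1 * E.2 - D.2 * E.1 ≠ 0 := by
    intro h0
    apply hD
    by_cases h1 : E.1 = 0
    · have h2 : E.2 ≠ 0 := fun h2 => hE0 (Prod.ext h1 h2)
      have : D = (D.2 / E.2) • E := by
        ext
        · simp only [Prod.smul_fst, h1, smul_zero]
          simpa [h1, h2] using h0
        · simp [h2]
      rw [this]
      exact hE.smul _
    · have : D = (D.1 / E.1) • E := by
        ext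
        · simp [h1]
        · simp only [Prod.smul_snd, smul_eq_mul]
          field_simp
          linear_combination -h0
      rw [this]
      exact hE.smul _
  refine ⟨(P.1 * E.2 - P.2 * E.1) / (D.1 * E.2 - D.2 * E.1),
    (D.1 * P.2 - D.2 * P.1) / (D.1 * E.2 - D.2 * E.1), ?_⟩
  ext <;>
  · simp only [Prod.fst_add, Prod.snd_add, Prod.smul_fst, Prod.smul_snd, smul_eq_mul]
    rw [div_mul_eq_mul_div, div_mul_eq_mul_div, ← add_div, eq_div_iff hdet]
    ring

theorem InvariantAlong.second_difference_eq_zero {A : Type*} [AddCommGroup A] {h₁ h₂ : F × F → A}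
    {D₁ D₂ D₃ : F × F} (i₁ : InvariantAlong h₁ D₁) (i₂ : InvariantAlong h₂ D₂)
    (i₃ : InvariantAlong (h₁ + h₂) D₃) (h20 : D₂ ≠ 0) (h30 : D₃ ≠ 0)
    (hne : ¬ InvariantAlong h₂ D₁) (P Q : F × F) :
    h₁ (P + Q) - h₁ P - h₁ Q + h₁ 0 = 0 := by
  have hne3 : ¬ InvariantAlong (h₁ + h₂) D₁ := fun hc => hne fun R u => by
    have := hc R u
    simpa [i₁ R u] using this
  obtain ⟨a, s, rfl⟩ := exists_eq_smul_add_smul_of_not_invariantAlong i₂ h20 hne P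
  obtain ⟨b, t, rfl⟩ := exists_eq_smul_add_smul_of_not_invariantAlong i₃ h30 hne3 Q
  have e1 : h₁ (a • D₁ + s • D₂ + (b • D₁ + t • D₃)) = h₁ (s • D₂ + t • D₃) := by
    rw [← i₁ (s • D₂ + t • D₃) (a + b)]
    congr 1
    module
  have e2 : h₁ (a • D₁ + s • D₂) = h₁ (s • D₂) := by rw [add_comm, i₁]
  have e3 : h₁ (b • D₁ + t • D₃) = h₁ (t • D₃) := by rw [add_comm, i₁]
  have f1 := i₃ (s • D₂) t
  have f2 := i₃ 0 t
  have f3 := i₂ (t • D₃) s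
  have f4 := i₂ 0 s
  rw [add_comm] at f3
  simp only [zero_add, Pi.add_apply] at f1 f2 f3 f4
  rw [e1, e2, e3]
  have g1 : h₁ (s • D₂ + t • D₃) = h₁ (s • D₂) + h₂ (s • D₂) - h₂ (s • D₂ + t • D₃) :=
    eq_sub_of_add_eq f1
  have g2 : h₁ (t • D₃) = h₁ 0 + h₂ 0 - h₂ (t • D₃) := eq_sub_of_add_eq f2
  rw [g1, g2, f3, f4]
  abel

variable [Fintype F]

theorem sum_eq_card_mul_of_lines (g : F → F → ℤ) (a : F → ℤ) (b : ℤ)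
    (h1 : ∀ τ s, ∑ u, g u (s + u * τ) = a τ) (h2 : ∀ u, ∑ v, g u v = b) :
    b = Fintype.card F * g 0 0 := by
  classical
  have hp : (Fintype.card F : ℤ) ≠ 0 := by exact_mod_cast Fintype.card_ne_zero
  have hab : ∀ τ, a τ = b := by
    intro τ
    have e1 : ∑ s, ∑ u, g u (s + u * τ) = Fintype.card F * a τ := by simp [h1]
    have e2 : ∑ s, ∑ u, g u (s + u * τ) = Fintype.card F * b := by
      rw [Finset.sum_comm]
      have : ∀ u, ∑ s, g u (s + u * τ) = b := fun u => by
        rw [← h2 u]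
        exact Fintype.sum_equiv (Equiv.addRight (u * τ)) _ _ fun _ => rfl
      simp [this]
    exact mul_left_cancel₀ hp (e1.symm.trans e2)
  have e1 : ∑ τ, ∑ u, g u (u * τ) = Fintype.card F * b := by
    have : ∀ τ, ∑ u, g u (u * τ) = b := fun τ => by simpa [hab] using h1 τ 0
    simp [this]
  have e2 : ∑ τ, ∑ u, g u (u * τ) =
      ∑ u : F, (b + if u = 0 then Fintype.card F * g 0 0 - b else 0) := by
    rw [Finset.sum_comm]
    refine Finset.sum_congr rfl fun u _ => ?_
    split_ifs with hu
    · simp [hu]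
    · simpa [mul_comm, h2] using sum_affine (g u) 0 hu
  rw [e1, Finset.sum_add_distrib] at e2
  simp at e2
  linarith

open scoped Classical in
theorem exists_invariantAlong (hp : (Fintype.card F).Prime) {α : Type*} (h : F × F → α)
    (hh : ∀ D : F × F, D ≠ 0 → ∀ P P' c,
      ∑ u : F, (if h (P + u • D) = c then (1 : F) else 0) =
        ∑ u : F, (if h (P' + u • D) = c then (1 : F) else 0)) :
    ∃ D : F × F, D ≠ 0 ∧ InvariantAlong h D := by
  have := Fact.mk hp
  have := charP_of_card_eq_prime (R := F) (p := Fintype.card F) rfl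
  by_contra! hcon
  let N : F × F → F × F → α → ℕ := fun D P c =>
    (Finset.univ.filter fun u : F => h (P + u • D) = c).card
  have hN : ∀ D, D ≠ 0 → ∀ P P' c, (N D P c : F) = N D P' c := by
    intro D hD P P' c
    simpa [N, Finset.sum_boole] using hh D hD P P' c
  have hle : ∀ D P c, N D P c ≤ Fintype.card F := fun D P c => Finset.card_le_univ _
  have hfull : ∀ {D P : F × F} {c : α}, N D P c = Fintype.card F → ∀ u : F, h (P + u • D) = c := by
    intro D P c hc u
    have := (Finset.card_eq_iff_eq_univ _).1 hc
    have hu := Finset.mem_univ u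
    rw [← this] at hu
    simpa using hu
  have hlt : ∀ D, D ≠ 0 → ∀ P c, N D P c < Fintype.card F := by
    intro D hD P c
    refine lt_of_le_of_ne (hle D P c) fun hc => hcon D hD fun P' u => ?_
    have hzero : (N D P (h P') : F) = 0 := by
      by_cases hc' : h P' = c
      · rw [hc', hc, FiniteField.cast_card_eq_zero]
      · have : N D P (h P') = 0 := by
          rw [Finset.card_eq_zero, Finset.filter_eq_empty_iff]
          intro v _ hv
          exact hc' (hv.symm.trans (hfull hc v))
        rw [this, Nat.cast_zero]
    rw [hN D hD P P', CharP.cast_eq_zero_iff F (Fintype.card F)] at hzero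
    have hpos : 0 < N D P' (h P') := Finset.card_pos.2 ⟨0, by simp⟩
    exact hfull (le_antisymm (hle _ _ _) (Nat.le_of_dvd hpos hzero)) u
  have hNat : ∀ D, D ≠ 0 → ∀ P P' c, N D P c = N D P' c := fun D hD P P' c =>
    CharP.natCast_injOn_Iio F (Fintype.card F) (hlt D hD P c) (hlt D hD P' c) (hN D hD P P' c)
  have hmain := sum_eq_card_mul_of_lines (fun u v : F => if h (u, v) = h 0 then (1 : ℤ) else 0)
    (fun τ => N (1, τ) 0 (h 0)) (N (0, 1) 0 (h 0))
    (fun τ s => by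
      rw [hNat (1, τ) (by simp) 0 (0, s)]
      simp [N, Finset.sum_boole])
    (fun u => by
      rw [hNat (0, 1) (by simp) 0 (u, 0)]
      simp [N, Finset.sum_boole])
  have hl := hlt (0, 1) (by simp) 0 (h 0)
  have h00 : ((0 : F), (0 : F)) = 0 := rfl
  simp only [h00, if_true, mul_one, Nat.cast_inj] at hmain
  exact hl.ne hmain

end Plane

section NullVectors

variable {F ι : Type*} [Field F] [Fintype ι]

theorem exists_dotProduct_ne_zero {a : ι → F} (ha : a ≠ 0) : ∃ w, a ⬝ᵥ w ≠ 0 := by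
  by_contra! hall
  exact ha ((dotProduct_eq_zero_iff).1 hall)

theorem exists_dotProduct_eq_one {a : ι → F} (ha : a ≠ 0) : ∃ w, a ⬝ᵥ w = 1 := by
  obtain ⟨w, hw⟩ := exists_dotProduct_ne_zero ha
  exact ⟨(a ⬝ᵥ w)⁻¹ • w, by rw [dotProduct_smul, smul_eq_mul, inv_mul_cancel₀ hw]⟩

theorem sub_smul_dotProduct_self (h2 : (2 : F) ≠ 0) {a v : ι → F} (ha : a ⬝ᵥ a = 0)
    (hav : a ⬝ᵥ v ≠ 0) :
    (v - (v ⬝ᵥ v / (2 * (a ⬝ᵥ v))) • a) ⬝ᵥ (v - (v ⬝ᵥ v / (2 * (a ⬝ᵥ v))) • a) = 0 := by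
  simp only [sub_dotProduct, dotProduct_sub, smul_dotProduct, dotProduct_smul, smul_eq_mul, ha,
    dotProduct_comm v a]
  field_simp
  ring

/-- A vector which is not a multiple of `a` is not orthogonal to the whole hyperplane orthogonal
to `a`. -/
theorem exists_perp_dotProduct_ne_zero {a κ : ι → F} (h : ∀ c : F, κ ≠ c • a) :
    ∃ w, a ⬝ᵥ w = 0 ∧ κ ⬝ᵥ w ≠ 0 := by
  by_contra! hall
  rcases eq_or_ne a 0 with rfl | ha
  · refine h 0 ?_
    rw [zero_smul]
    exact dotProduct_eq_zero_iff.1 fun w => hall w (zero_dotProduct w)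
  · obtain ⟨w₁, hw₁⟩ := exists_dotProduct_eq_one ha
    refine h (κ ⬝ᵥ w₁) (dotProduct_eq _ _ fun w => ?_)
    have := hall (w - (a ⬝ᵥ w) • w₁) (by simp [dotProduct_sub, dotProduct_smul, hw₁])
    simp only [dotProduct_sub, dotProduct_smul, smul_eq_mul] at this
    rw [smul_dotProduct, smul_eq_mul]
    linear_combination this

/-- An additive subgroup contains the hyperplane orthogonal to `a` if it contains a null line of
this hyperplane and all null vectors of this hyperplane which are not orthogonal to that line. -/
theorem mem_of_null_perp_mem (h2 : (2 : F) ≠ 0) {a κ w₀ : ι → F} (hκ : κ ⬝ᵥ κ = 0)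
    (haκ : a ⬝ᵥ κ = 0) (haw : a ⬝ᵥ w₀ = 0) (hκw : κ ⬝ᵥ w₀ ≠ 0) (S : AddSubgroup (ι → F))
    (hSκ : ∀ c : F, c • κ ∈ S) (hS : ∀ v, v ⬝ᵥ v = 0 → a ⬝ᵥ v = 0 → κ ⬝ᵥ v ≠ 0 → v ∈ S)
    (v : ι → F) (hv : a ⬝ᵥ v = 0) : v ∈ S := by
  have main : ∀ v, a ⬝ᵥ v = 0 → κ ⬝ᵥ v ≠ 0 → v ∈ S := by
    intro v hv hκv
    rw [← sub_add_cancel v ((v ⬝ᵥ v / (2 * (κ ⬝ᵥ v))) • κ)]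
    refine S.add_mem (hS _ (sub_smul_dotProduct_self h2 hκ hκv) ?_ ?_) (hSκ _) <;>
    simp [dotProduct_sub, dotProduct_smul, hv, haκ, hκ, hκv]
  by_cases hκv : κ ⬝ᵥ v = 0
  · rw [← add_sub_cancel_right v w₀]
    refine S.sub_mem (main _ ?_ ?_) (main _ haw hκw) <;> simp [dotProduct_add, hv, haw, hκv, hκw]
  · exact main v hv hκv

theorem mem_of_null_line_mem (h2 : (2 : F) ≠ 0) {κ : ι → F} (hκ : κ ⬝ᵥ κ = 0) (hκ0 : κ ≠ 0)
    (S : AddSubgroup (ι → F)) (hSκ : ∀ c : F, c • κ ∈ S)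
    (hS : ∀ v, v ⬝ᵥ v = 0 → κ ⬝ᵥ v ≠ 0 → v ∈ S) (v : ι → F) : v ∈ S := by
  obtain ⟨w, hw⟩ := exists_dotProduct_ne_zero hκ0
  exact mem_of_null_perp_mem h2 hκ (zero_dotProduct κ) (zero_dotProduct w) hw S hSκ
    (fun v hv _ => hS v hv) v (zero_dotProduct v)

theorem mem_of_null_mem (h2 : (2 : F) ≠ 0) {κ : ι → F} (hκ : κ ⬝ᵥ κ = 0) (hκ0 : κ ≠ 0)
    (S : AddSubgroup (ι → F)) (hS : ∀ v, v ⬝ᵥ v = 0 → v ∈ S) (v : ι → F) : v ∈ S :=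
  mem_of_null_line_mem h2 hκ hκ0 S (fun c => hS _ (by simp [dotProduct_smul, smul_dotProduct, hκ]))
    (fun v hv _ => hS v hv) v

/-- The additive subgroup of vectors orthogonal to `v`. -/
def perpAddSubgroup (v : ι → F) : AddSubgroup (ι → F) where
  carrier := {m | m ⬝ᵥ v = 0}
  add_mem' := by
    intro a b ha hb
    simp_all [add_dotProduct]
  zero_mem' := zero_dotProduct v
  neg_mem' := by
    intro a ha
    simp_all [neg_dotProduct]

theorem eq_zero_of_null_dotProduct (h2 : (2 : F) ≠ 0) {κ : ι → F} (hκ : κ ⬝ᵥ κ = 0) (hκ0 : κ ≠ 0)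
    {v : ι → F} (hv : ∀ m, m ⬝ᵥ m = 0 → m ⬝ᵥ v = 0) : v = 0 :=
  dotProduct_eq_zero_iff.1 fun m =>
    (dotProduct_comm v m).trans (mem_of_null_mem h2 hκ hκ0 (perpAddSubgroup v) hv m)

theorem dotProduct_eq_zero_of_null_perp (h2 : (2 : F) ≠ 0) {a κ : ι → F} (hκ : κ ⬝ᵥ κ = 0)
    (haκ : a ⬝ᵥ κ = 0) (hcκ : ∀ c : F, κ ≠ c • a) {v : ι → F}
    (hv : ∀ m, m ⬝ᵥ m = 0 → a ⬝ᵥ m = 0 → m ⬝ᵥ v = 0) {m : ι → F} (hm : a ⬝ᵥ m = 0) :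
    m ⬝ᵥ v = 0 := by
  obtain ⟨w, haw, hκw⟩ := exists_perp_dotProduct_ne_zero hcκ
  exact mem_of_null_perp_mem h2 hκ haκ haw hκw (perpAddSubgroup v)
    (fun c => hv _ (by simp [dotProduct_smul, smul_dotProduct, hκ])
      (by simp [dotProduct_smul, haκ]))
    (fun m hm ham _ => hv m hm ham) m hm

theorem exists_null_dotProduct_ne_zero (h2 : (2 : F) ≠ 0) {a : ι → F} (ha : a ⬝ᵥ a = 0)
    (ha0 : a ≠ 0) : ∃ b, b ⬝ᵥ b = 0 ∧ a ⬝ᵥ b ≠ 0 := by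
  obtain ⟨w, hw⟩ := exists_dotProduct_ne_zero ha0
  exact ⟨_, sub_smul_dotProduct_self h2 ha hw, by simp [dotProduct_sub, dotProduct_smul, ha, hw]⟩

theorem exists_anisotropic_perp (h2 : (2 : F) ≠ 0) (hι : 3 ≤ Fintype.card ι) {a b : ι → F}
    (ha : a ⬝ᵥ a = 0) (hb : b ⬝ᵥ b = 0) (hab : a ⬝ᵥ b ≠ 0) :
    ∃ e, a ⬝ᵥ e = 0 ∧ b ⬝ᵥ e = 0 ∧ e ⬝ᵥ e ≠ 0 := by
  classical
  by_contra! hall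
  let π : (ι → F) → (ι → F) := fun u => u - (b ⬝ᵥ u / (a ⬝ᵥ b)) • a - (a ⬝ᵥ u / (a ⬝ᵥ b)) • b
  have hπa : ∀ u, a ⬝ᵥ π u = 0 := fun u => by
    simp [π, dotProduct_sub, dotProduct_smul, ha, hab]
  have hπb : ∀ u, b ⬝ᵥ π u = 0 := fun u => by
    simp [π, dotProduct_sub, dotProduct_smul, hb, hab, dotProduct_comm b a]
  have hππ : ∀ u v, π u ⬝ᵥ π v = 0 := by
    intro u v
    have h1 := hall (π u + π v) (by simp [dotProduct_add, hπa]) (by simp [dotProduct_add, hπb])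
    rw [add_dotProduct, dotProduct_add, dotProduct_add, hall _ (hπa u) (hπb u),
      hall _ (hπa v) (hπb v), dotProduct_comm (π v)] at h1
    have : 2 * (π u ⬝ᵥ π v) = 0 := by linear_combination h1
    exact (mul_eq_zero.1 this).resolve_left h2
  have hπ : ∀ u, π u = 0 := fun u => dotProduct_eq_zero_iff.1 fun v => by
    have h1 := hππ u v
    have h3 := hπa u
    have h4 := hπb u
    rw [dotProduct_comm] at h3 h4
    simpa [show π v = v - (b ⬝ᵥ v / (a ⬝ᵥ b)) • a - (a ⬝ᵥ v / (a ⬝ᵥ b)) • b from rfl,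
      dotProduct_sub, dotProduct_smul, h3, h4] using h1
  have hspan : (⊤ : Submodule F (ι → F)) ≤
      Submodule.span F (({a, b} : Finset (ι → F)) : Set _) := by
    intro u _
    have : u = (b ⬝ᵥ u / (a ⬝ᵥ b)) • a + (a ⬝ᵥ u / (a ⬝ᵥ b)) • b := by
      have := hπ u
      simp only [π] at this
      rw [sub_sub, sub_eq_zero] at this
      exact this
    rw [this]
    exact add_mem (Submodule.smul_mem _ _ (Submodule.subset_span (by simp)))
      (Submodule.smul_mem _ _ (Submodule.subset_span (by simp)))
  have h3 := finrank_span_finset_le_card (R := F) ({a, b} : Finset (ι → F))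
  rw [Set.finrank, top_le_iff.1 hspan, finrank_top, Module.finrank_fintype_fun_eq_card] at h3
  have := Finset.card_le_two (a := a) (b := b)
  omega

/-- A null vector `a ≠ 0` completed by a null vector `b` and an anisotropic vector `e`, scaled such
that `a + c • b + e` and `a + c • b - e` are null. -/
theorem exists_null_frame (h2 : (2 : F) ≠ 0) (hι : 3 ≤ Fintype.card ι) {a : ι → F}
    (ha : a ⬝ᵥ a = 0) (ha0 : a ≠ 0) :
    ∃ (b e : ι → F) (c : F), b ⬝ᵥ b = 0 ∧ a ⬝ᵥ b ≠ 0 ∧ a ⬝ᵥ e = 0 ∧ b ⬝ᵥ e = 0 ∧ e ⬝ᵥ e ≠ 0 ∧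
      c ≠ 0 ∧ 2 * c * (a ⬝ᵥ b) + e ⬝ᵥ e = 0 := by
  obtain ⟨b, hb, hab⟩ := exists_null_dotProduct_ne_zero h2 ha ha0
  obtain ⟨e, hae, hbe, he⟩ := exists_anisotropic_perp h2 hι ha hb hab
  refine ⟨b, e, -(e ⬝ᵥ e) / (2 * (a ⬝ᵥ b)), hb, hab, hae, hbe, he, ?_, ?_⟩
  · exact div_ne_zero (neg_ne_zero.2 he) (mul_ne_zero h2 hab)
  · field_simp
    ring

theorem null_frame_add {a b e : ι → F} {c : F} (ha : a ⬝ᵥ a = 0) (hb : b ⬝ᵥ b = 0)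
    (hae : a ⬝ᵥ e = 0) (hbe : b ⬝ᵥ e = 0) (hc : 2 * c * (a ⬝ᵥ b) + e ⬝ᵥ e = 0) :
    (a + c • b + e) ⬝ᵥ (a + c • b + e) = 0 := by
  simp only [add_dotProduct, dotProduct_add, smul_dotProduct, dotProduct_smul, smul_eq_mul, ha, hb,
    hae, hbe, dotProduct_comm e a, dotProduct_comm e b, dotProduct_comm b a]
  linear_combination hc

theorem exists_null_vector [Fintype F] {n : ℕ} (hp : (Fintype.card F).Prime) (hn : 3 ≤ n) :
    ∃ a : Fin n → F, a ⬝ᵥ a = 0 ∧ a ≠ 0 := by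
  have := Fact.mk hp
  have := charP_of_card_eq_prime (R := F) (p := Fintype.card F) rfl
  obtain ⟨α, β, h⟩ := CharP.sq_add_sq F (Fintype.card F) (-1)
  refine ⟨Pi.single ⟨0, by omega⟩ 1 + Pi.single ⟨1, by omega⟩ (α : F) +
    Pi.single ⟨2, by omega⟩ (β : F), ?_, fun h0 => ?_⟩
  · simp
    linear_combination h
  · simpa [Pi.single_apply, Fin.ext_iff] using congrFun h0 ⟨0, by omega⟩

theorem exists_null_perp [Fintype F] {n : ℕ} (hp : (Fintype.card F).Prime) (hn : 4 ≤ n)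
    (a : Fin n → F) :
    ∃ κ : Fin n → F, κ ⬝ᵥ κ = 0 ∧ a ⬝ᵥ κ = 0 ∧ ∀ c : F, κ ≠ c • a := by
  have := Fact.mk hp
  have := charP_of_card_eq_prime (R := F) (p := Fintype.card F) rfl
  obtain ⟨α, β, h⟩ := CharP.sq_add_sq F (Fintype.card F) (-1)
  have key : ∃ u v : Fin n → F, u ⬝ᵥ u = 0 ∧ v ⬝ᵥ v = 0 ∧ u ⬝ᵥ v = 0 ∧
      u ⟨0, by omega⟩ = 1 ∧ u ⟨1, by omega⟩ = 0 ∧ v ⟨0, by omega⟩ = 0 ∧ v ⟨1, by omega⟩ = 1 := by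
    refine ⟨Pi.single ⟨0, by omega⟩ 1 + Pi.single ⟨2, by omega⟩ (α : F) +
      Pi.single ⟨3, by omega⟩ (β : F), Pi.single ⟨1, by omega⟩ 1 - Pi.single ⟨2, by omega⟩ (β : F) +
      Pi.single ⟨3, by omega⟩ (α : F), ?_, ?_, ?_, ?_, ?_, ?_, ?_⟩ <;> simp
    · linear_combination h
    · linear_combination h
    · ring
  obtain ⟨u, v, hu, hv, huv, hu0, hu1, hv0, hv1⟩ := key
  by_cases hau : a ⬝ᵥ u = 0 ∧ a ⬝ᵥ v = 0
  · by_cases hcu : ∀ c : F, u ≠ c • a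
    · exact ⟨u, hu, hau.1, hcu⟩
    · refine ⟨v, hv, hau.2, fun d hd => ?_⟩
      push Not at hcu
      obtain ⟨c, hc⟩ := hcu
      rw [hc] at hu0
      rw [hd] at hv0 hv1
      simp only [Pi.smul_apply, smul_eq_mul] at hu0 hv0 hv1
      rcases mul_eq_zero.1 hv0 with h | h
      · simp [h] at hv1
      · simp [h] at hu0
  · refine ⟨(a ⬝ᵥ v) • u - (a ⬝ᵥ u) • v, ?_, ?_, fun c hc => hau ?_⟩
    · simp [sub_dotProduct, dotProduct_sub, smul_dotProduct, dotProduct_smul, hu, hv, huv,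
        dotProduct_comm v u]
    · simp only [dotProduct_sub, dotProduct_smul, smul_eq_mul]
      ring
    · have e0 := congrFun hc ⟨0, by omega⟩
      have e1 := congrFun hc ⟨1, by omega⟩
      have e2 := congrArg (u ⬝ᵥ ·) hc
      have e3 := congrArg (v ⬝ᵥ ·) hc
      simp only [dotProduct_sub, dotProduct_smul, smul_eq_mul, hu, hv, huv, dotProduct_comm v u,
        mul_zero, sub_zero, dotProduct_comm u a, dotProduct_comm v a] at e2 e3
      simp only [Pi.sub_apply, Pi.smul_apply, hu0, hu1, hv0, hv1, smul_eq_mul, mul_one, mul_zero,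
        sub_zero, zero_sub] at e0 e1
      rcases eq_or_ne c 0 with rfl | hc0
      · simp at e0 e1
        exact ⟨e1, e0⟩
      · exact ⟨(mul_eq_zero.1 e2.symm).resolve_left hc0, (mul_eq_zero.1 e3.symm).resolve_left hc0⟩

end NullVectors

section SecondDifference

variable {A B : Type*} [AddCommGroup A] [AddCommGroup B]

/-- The mixed second difference of `f` at `x` in the directions `u` and `v`. -/
def secondDiff (f : A → B) (x u v : A) : B := f (x + u + v) - f (x + u) - f (x + v) + f x

theorem secondDiff_comm (f : A → B) (x u v : A) : secondDiff f x u v = secondDiff f x v u := by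
  simp only [secondDiff, add_right_comm x u v]
  abel

theorem secondDiff_add_right (f : A → B) (x u v w : A) :
    secondDiff f x u (v + w) = secondDiff f (x + v) u w + secondDiff f x u v := by
  simp only [secondDiff, add_right_comm x v u, ← add_assoc]
  abel

@[simp] theorem secondDiff_zero_right (f : A → B) (x u : A) : secondDiff f x u 0 = 0 := by
  simp [secondDiff]

@[simp] theorem secondDiff_zero_left (f : A → B) (x u : A) : secondDiff f x 0 u = 0 := by
  simp [secondDiff]

theorem secondDiff_neg_right (f : A → B) (x u v : A) :
    secondDiff f x u (-v) = -secondDiff f (x - v) u v := by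
  have := secondDiff_add_right f x u (-v) v
  rw [neg_add_cancel, secondDiff_zero_right, ← sub_eq_add_neg] at this
  exact (neg_eq_of_add_eq_zero_right this.symm).symm

theorem secondDiff_add_base (f : A → B) (x z u v : A) :
    secondDiff f (x + z) u v =
      secondDiff f x u v + secondDiff f (x + v) u z - secondDiff f x u z := by
  have h1 := secondDiff_add_right f x u z v
  have h2 := secondDiff_add_right f x u v z
  rw [add_comm z v, h2] at h1
  rw [add_comm (secondDiff f x u v), h1, add_sub_cancel_right]

/-- The directions `v` in which the second differences of `f` with fixed first direction `u` have a
value not depending on the base point. -/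
def constDiffSubgroup (f : A → B) (u : A) : AddSubgroup A where
  carrier := {v | ∀ x z, secondDiff f (x + z) u v = secondDiff f x u v}
  add_mem' := by
    intro v w hv hw x z
    rw [secondDiff_add_right, secondDiff_add_right, hv, add_right_comm, hw]
  zero_mem' := by simp
  neg_mem' := by
    intro v hv x z
    rw [secondDiff_neg_right, secondDiff_neg_right, add_sub_right_comm, hv]

/-- The directions `v` in which the second differences of `f` with fixed first direction `u`
vanish. -/
def zeroDiffSubgroup (f : A → B) (u : A) : AddSubgroup A where
  carrier := {v | ∀ x, secondDiff f x u v = 0}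
  add_mem' := by
    intro v w hv hw x
    rw [secondDiff_add_right, hv, hw, add_zero]
  zero_mem' := by simp
  neg_mem' := by
    intro v hv x
    rw [secondDiff_neg_right, hv, neg_zero]

end SecondDifference

section PrimeField

variable {F V W : Type*} [Field F] [Fintype F] [AddCommGroup V] [Module F V] [AddCommGroup W]
  [Module F W]

theorem AddMonoidHom.map_smul_of_prime_card (hp : (Fintype.card F).Prime) (f : V →+ W) (c : F)
    (v : V) : f (c • v) = c • f v := by
  have := Fact.mk hp
  have := charP_of_card_eq_prime (R := F) (p := Fintype.card F) rfl
  obtain ⟨z, rfl⟩ := (ZMod.castHom_bijective F (n := Fintype.card F) rfl).2 c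
  rw [ZMod.castHom_apply, ← ZMod.natCast_val, Nat.cast_smul_eq_nsmul, Nat.cast_smul_eq_nsmul,
    map_nsmul]

theorem exists_affine_of_secondDiff_eq_zero (hp : (Fintype.card F).Prime) (γ : V ≃ W)
    (h : ∀ x y, secondDiff γ 0 x y = 0) :
    ∃ (L : V →ₗ[F] W) (b : W), Function.Bijective L ∧ ∀ x, γ x = L x + b := by
  let f : V →+ W := AddMonoidHom.mk' (fun x => γ x - γ 0) fun x y => by
    have := h x y
    simp only [secondDiff, zero_add] at this
    rw [← sub_eq_zero, ← this]
    abel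
  refine ⟨{ f with map_smul' := f.map_smul_of_prime_card hp }, γ 0, ?_, fun x => ?_⟩
  · exact (Equiv.subRight (γ 0)).bijective.comp γ.bijective
  · exact (sub_add_cancel (γ x) (γ 0)).symm

end PrimeField

section DimensionAtLeastFour

variable {F ι : Type*} [Field F] [Fintype ι]

/-- The restriction of `m ⬝ᵥ γ` to the plane through `x` spanned by `a` and `b`. -/
def planeFunction (γ : (ι → F) → (ι → F)) (x a b m : ι → F) (P : F × F) : F :=
  m ⬝ᵥ γ (x + P.1 • a + P.2 • b)

theorem planeFunction_add (γ : (ι → F) → (ι → F)) (x a b m m' : ι → F) :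
    planeFunction γ x a b (m + m') = planeFunction γ x a b m + planeFunction γ x a b m' :=
  funext fun _ => add_dotProduct _ _ _

theorem planeFunction_smul (γ : (ι → F) → (ι → F)) (x a b m : ι → F) (c : F) (P : F × F) :
    planeFunction γ x a b (c • m) P = c * planeFunction γ x a b m P :=
  smul_dotProduct _ _ _

theorem not_invariantAlong_all {γ : (ι → F) ≃ (ι → F)} {x a b : ι → F}
    (hab : ∀ s t : F, s • a + t • b = 0 → s = 0 ∧ t = 0) {D : F × F} (hD : D ≠ 0) :
    ∃ m, ¬ InvariantAlong (planeFunction γ x a b m) D := by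
  by_contra! hall
  have h1 : γ (x + D.1 • a + D.2 • b) = γ x := dotProduct_eq _ _ fun m => by
    have := hall m 0 1
    simp only [planeFunction, zero_add, one_smul, Prod.fst_zero, Prod.snd_zero, zero_smul,
      add_zero] at this
    rw [dotProduct_comm, this, dotProduct_comm]
  have h2 := γ.injective h1
  rw [add_assoc, add_eq_left] at h2
  exact hD (Prod.ext_iff.2 (hab _ _ h2))

variable [Fintype F]

theorem IsIntegralPerm.exists_invariantAlong (hp : (Fintype.card F).Prime) (h2 : (2 : F) ≠ 0)
    {γ : (ι → F) ≃ (ι → F)} (hγ : IsIntegralPerm γ) {a b m : ι → F} (ha : a ⬝ᵥ a = 0)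
    (hb : b ⬝ᵥ b = 0) (hab : a ⬝ᵥ b = 0) (hm : m ⬝ᵥ m = 0) (x : ι → F) :
    ∃ D, D ≠ 0 ∧ InvariantAlong (planeFunction γ x a b m) D := by
  classical
  refine _root_.exists_invariantAlong hp _ fun D _ P P' c => ?_
  have h := hγ.sum_line_congr h2 (d := D.1 • a + D.2 • b) (m := m)
    (x := x + P.1 • a + P.2 • b) (x' := x + P'.1 • a + P'.2 • b)
    (by simp [dotProduct_add, add_dotProduct, dotProduct_smul, smul_dotProduct, ha, hb, hab,
      dotProduct_comm b a]) hm
    (by simp [dotProduct_add, add_dotProduct, dotProduct_smul, smul_dotProduct, ha, hb, hab,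
      dotProduct_comm b a]) c
  have hP : ∀ (P : F × F) (u : F), x + (P + u • D).1 • a + (P + u • D).2 • b =
      x + P.1 • a + P.2 • b + u • (D.1 • a + D.2 • b) := by
    intro P u
    simp only [Prod.fst_add, Prod.snd_add, Prod.smul_fst, Prod.smul_snd, smul_eq_mul]
    module
  simp only [planeFunction, hP]
  convert h

theorem IsIntegralPerm.planeFunction_second_difference (hp : (Fintype.card F).Prime)
    (h2 : (2 : F) ≠ 0) {n : ℕ} (hn : 4 ≤ n) {γ : (Fin n → F) ≃ (Fin n → F)}
    (hγ : IsIntegralPerm γ) {a b : Fin n → F} (ha : a ⬝ᵥ a = 0) (hb : b ⬝ᵥ b = 0)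
    (hab : a ⬝ᵥ b = 0) (hind : ∀ s t : F, s • a + t • b = 0 → s = 0 ∧ t = 0) (x : Fin n → F)
    {m : Fin n → F} (hm : m ⬝ᵥ m = 0) (P Q : F × F) :
    planeFunction γ x a b m (P + Q) - planeFunction γ x a b m P - planeFunction γ x a b m Q +
      planeFunction γ x a b m 0 = 0 := by
  rcases eq_or_ne m 0 with rfl | hm0
  · simp [planeFunction]
  have hinv {m : Fin n → F} (hm : m ⬝ᵥ m = 0) := hγ.exists_invariantAlong hp h2 ha hb hab hm x
  obtain ⟨D, hD0, hD⟩ := hinv hm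
  by_cases hcase : ∃ m', m' ⬝ᵥ m' = 0 ∧ m ⬝ᵥ m' = 0 ∧ ¬ InvariantAlong (planeFunction γ x a b m') D
  · obtain ⟨m', hm', hmm', hD'⟩ := hcase
    obtain ⟨D₂, h20, hD₂⟩ := hinv hm'
    obtain ⟨D₃, h30, hD₃⟩ := hinv (m := m + m')
      (by simp [dotProduct_add, add_dotProduct, hm, hm', hmm', dotProduct_comm m' m])
    rw [planeFunction_add] at hD₃
    exact hD.second_difference_eq_zero hD₂ hD₃ h20 h30 hD' P Q
  · push Not at hcase
    obtain ⟨κ, hκ, hmκ, hκm⟩ := exists_null_perp hp hn m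
    have hperp : ∀ v, m ⬝ᵥ v = 0 → InvariantAlong (planeFunction γ x a b v) D := by
      intro v hv P u
      have := dotProduct_eq_zero_of_null_perp h2 hκ hmκ hκm
        (v := γ (x + (P + u • D).1 • a + (P + u • D).2 • b) - γ (x + P.1 • a + P.2 • b))
        (fun v hv hmv => by
          rw [dotProduct_sub, sub_eq_zero]
          exact hcase v hv hmv P u) hv
      rwa [dotProduct_sub, sub_eq_zero] at this
    obtain ⟨l, e, c, hl, hml, hme, hle, -, hc0, hc⟩ :=
      exists_null_frame h2 (by simpa using hn.trans' (by norm_num)) hm hm0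
    have hlD : ¬ InvariantAlong (planeFunction γ x a b (c • l)) D := by
      intro hcl
      obtain ⟨v, hv⟩ := not_invariantAlong_all (γ := γ) (x := x) hind hD0
      refine hv fun R u => ?_
      have e1 := hperp (v - ((m ⬝ᵥ v) / (m ⬝ᵥ l)) • l)
        (by simp [dotProduct_sub, dotProduct_smul, hml]) R u
      have e2 : planeFunction γ x a b l (R + u • D) = planeFunction γ x a b l R := by
        have := hcl R u
        rw [planeFunction_smul, planeFunction_smul] at this
        exact mul_left_cancel₀ hc0 this
      simp only [planeFunction, sub_dotProduct, smul_dotProduct] at e1 e2 ⊢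
      rw [e2] at e1
      exact sub_left_injective e1
    obtain ⟨D₂, h20, hD₂⟩ := hinv (m := c • l) (by simp [dotProduct_smul, smul_dotProduct, hl])
    have haux : ∀ e, m ⬝ᵥ e = 0 → l ⬝ᵥ e = 0 → 2 * c * (m ⬝ᵥ l) + e ⬝ᵥ e = 0 →
        planeFunction γ x a b (m + e) (P + Q) - planeFunction γ x a b (m + e) P -
          planeFunction γ x a b (m + e) Q + planeFunction γ x a b (m + e) 0 = 0 := by
      intro e hme hle hc
      obtain ⟨D₃, h30, hD₃⟩ := hinv (null_frame_add hm hl hme hle hc)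
      rw [add_right_comm, planeFunction_add] at hD₃
      exact (hperp (m + e) (by simp [dotProduct_add, hm, hme])).second_difference_eq_zero
        hD₂ hD₃ h20 h30 hlD P Q
    have e1 := haux e hme hle hc
    have e2 := haux (-e) (by simp [hme]) (by simp [hle]) (by simpa using hc)
    simp only [planeFunction, add_dotProduct, neg_dotProduct] at e1 e2 ⊢
    refine (mul_eq_zero.1 (?_ : (2 : F) * _ = 0)).resolve_left h2
    linear_combination e1 + e2

theorem IsIntegralPerm.secondDiff_eq_zero_of_null (hp : (Fintype.card F).Prime)
    (h2 : (2 : F) ≠ 0) {n : ℕ} (hn : 4 ≤ n) {γ : (Fin n → F) ≃ (Fin n → F)}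
    (hγ : IsIntegralPerm γ) {a b : Fin n → F} (ha : a ⬝ᵥ a = 0) (hb : b ⬝ᵥ b = 0)
    (hab : a ⬝ᵥ b = 0) (x : Fin n → F) : secondDiff γ x a b = 0 := by
  rcases eq_or_ne a 0 with rfl | ha0
  · exact secondDiff_zero_left _ _ _
  have hplane : ∀ κ, κ ⬝ᵥ κ = 0 → a ⬝ᵥ κ = 0 → (∀ c : F, κ ≠ c • a) → ∀ s t : F,
      secondDiff γ x a (s • a + t • κ) = 0 := by
    intro κ hκ haκ hκa s t
    refine eq_zero_of_null_dotProduct h2 ha ha0 fun m hm => ?_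
    have h := hγ.planeFunction_second_difference hp h2 hn ha hκ haκ (fun s t hst => ?_) x hm
      (1, 0) (s, t)
    · simp only [planeFunction, Prod.fst_add, Prod.snd_add, Prod.fst_zero, Prod.snd_zero,
        zero_smul, add_zero, zero_add, add_smul, one_smul] at h
      simpa [secondDiff, dotProduct_add, dotProduct_sub, add_assoc] using h
    · have ht : t = 0 := by
        by_contra ht
        refine hκa (-(t⁻¹ * s)) ?_
        rw [neg_smul, mul_smul, eq_neg_iff_add_eq_zero, add_comm]
        have := congrArg (t⁻¹ • ·) hst
        simpa [smul_add, smul_smul, ht] using this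
      rw [ht, zero_smul, add_zero] at hst
      exact ⟨(smul_eq_zero.1 hst).resolve_right ha0, ht⟩
  by_cases hcb : ∃ c : F, b = c • a
  · obtain ⟨c, rfl⟩ := hcb
    obtain ⟨κ, hκ, haκ, hκa⟩ := exists_null_perp hp hn a
    simpa using hplane κ hκ haκ hκa c 0
  · push Not at hcb
    simpa using hplane b hb hab hcb 0 1

theorem IsIntegralPerm.secondDiff_eq_zero_of_perp (hp : (Fintype.card F).Prime)
    (h2 : (2 : F) ≠ 0) {n : ℕ} (hn : 4 ≤ n) {γ : (Fin n → F) ≃ (Fin n → F)}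
    (hγ : IsIntegralPerm γ) {a v : Fin n → F} (ha : a ⬝ᵥ a = 0) (hav : a ⬝ᵥ v = 0)
    (x : Fin n → F) : secondDiff γ x a v = 0 := by
  obtain ⟨κ, hκ, haκ, hκa⟩ := exists_null_perp hp hn a
  obtain ⟨w, haw, hκw⟩ := exists_perp_dotProduct_ne_zero hκa
  have hnull : ∀ b, b ⬝ᵥ b = 0 → a ⬝ᵥ b = 0 → b ∈ zeroDiffSubgroup γ a := fun b hb hab x =>
    hγ.secondDiff_eq_zero_of_null hp h2 hn ha hb hab x
  exact mem_of_null_perp_mem h2 hκ haκ haw hκw (zeroDiffSubgroup γ a)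
    (fun c => hnull _ (by simp [dotProduct_smul, smul_dotProduct, hκ])
      (by simp [dotProduct_smul, haκ]))
    (fun b hb hab _ => hnull b hb hab) v hav x

theorem IsIntegralPerm.secondDiff_add_base_eq (hp : (Fintype.card F).Prime)
    (h2 : (2 : F) ≠ 0) {n : ℕ} (hn : 4 ≤ n) {γ : (Fin n → F) ≃ (Fin n → F)}
    (hγ : IsIntegralPerm γ) (x z u v : Fin n → F) :
    secondDiff γ (x + z) u v = secondDiff γ x u v := by
  obtain ⟨a₀, ha₀, ha₀0⟩ := exists_null_vector (F := F) hp (hn.trans' (by norm_num))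
  have hperp {a z : Fin n → F} (ha : a ⬝ᵥ a = 0) (haz : a ⬝ᵥ z = 0) (x b : Fin n → F) :
      secondDiff γ (x + z) a b = secondDiff γ x a b := by
    rw [secondDiff_add_base, hγ.secondDiff_eq_zero_of_perp hp h2 hn ha haz,
      hγ.secondDiff_eq_zero_of_perp hp h2 hn ha haz, add_zero, sub_zero]
  have hnull {a b : Fin n → F} (ha : a ⬝ᵥ a = 0) (hb : b ⬝ᵥ b = 0) (x z : Fin n → F) :
      secondDiff γ (x + z) a b = secondDiff γ x a b := by
    by_cases hab : a ⬝ᵥ b = 0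
    · rw [hγ.secondDiff_eq_zero_of_perp hp h2 hn ha hab,
        hγ.secondDiff_eq_zero_of_perp hp h2 hn ha hab]
    · have hz : x + z = x + ((a ⬝ᵥ z) / (a ⬝ᵥ b)) • b + (z - ((a ⬝ᵥ z) / (a ⬝ᵥ b)) • b) := by abel
      rw [hz, hperp ha (by simp [dotProduct_sub, dotProduct_smul, hab]), secondDiff_comm,
        hperp hb (by simp [dotProduct_smul, hb]), secondDiff_comm]
  have hleft {a : Fin n → F} (ha : a ⬝ᵥ a = 0) (v : Fin n → F) : v ∈ constDiffSubgroup γ a :=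
    mem_of_null_mem h2 ha₀ ha₀0 (constDiffSubgroup γ a) (fun b hb x z => hnull ha hb x z) v
  have hright : u ∈ constDiffSubgroup γ v :=
    mem_of_null_mem h2 ha₀ ha₀0 (constDiffSubgroup γ v) (fun b hb x z => by
      rw [secondDiff_comm, hleft hb v x z, secondDiff_comm]) u
  rw [secondDiff_comm, hright x z, secondDiff_comm]

theorem IsIntegralPerm.secondDiff_eq_zero_of_four_le (hp : (Fintype.card F).Prime)
    (h2 : (2 : F) ≠ 0) {n : ℕ} (hn : 4 ≤ n) {γ : (Fin n → F) ≃ (Fin n → F)}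
    (hγ : IsIntegralPerm γ) (x y : Fin n → F) : secondDiff γ 0 x y = 0 := by
  have hbase := hγ.secondDiff_add_base_eq hp h2 hn
  let T (u : Fin n → F) : (Fin n → F) →+ (Fin n → F) :=
    AddMonoidHom.mk' (secondDiff γ 0 u) fun v w => by
      rw [secondDiff_add_right, hbase, add_comm]
  have hTcomm : ∀ u v, T u v = T v u := secondDiff_comm _ _
  have hTsmul : ∀ (c : F) u v, T u (c • v) = c • T u v := fun c u v =>
    (T u).map_smul_of_prime_card hp c v
  have hTnull : ∀ {a}, a ⬝ᵥ a = 0 → a ≠ 0 → ∃ κ, ∀ v, T a v = (a ⬝ᵥ v) • κ := by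
    intro a ha ha0
    obtain ⟨w, hw⟩ := exists_dotProduct_eq_one ha0
    refine ⟨T a w, fun v => ?_⟩
    have h := hγ.secondDiff_eq_zero_of_perp hp h2 hn (v := v - (a ⬝ᵥ v) • w) ha
      (by simp [dotProduct_sub, dotProduct_smul, hw]) 0
    change T a _ = 0 at h
    rwa [map_sub, hTsmul, sub_eq_zero] at h
  obtain ⟨a₀, ha₀, ha₀0⟩ := exists_null_vector (F := F) hp (hn.trans' (by norm_num))
  obtain ⟨κ, hκ⟩ := hTnull ha₀ ha₀0
  have hT : ∀ u v, T u v = (u ⬝ᵥ v) • κ := by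
    intro u v
    let S : AddSubgroup (Fin n → F) := (T v - AddMonoidHom.mk' (fun u => (v ⬝ᵥ u) • κ)
      fun u w => by rw [dotProduct_add, add_smul]).ker
    have hS : ∀ u, u ∈ S ↔ T v u = (v ⬝ᵥ u) • κ := fun u => by
      simp [S, AddMonoidHom.mem_ker, sub_eq_zero]
    have := mem_of_null_line_mem h2 ha₀ ha₀0 S
      (fun c => by rw [hS, hTsmul, hTcomm, hκ, dotProduct_smul, smul_smul, dotProduct_comm v,
        smul_eq_mul])
      (fun a ha ha' => by
        have ha0 : a ≠ 0 := fun h => ha' (by simp [h])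
        obtain ⟨κ', hκ'⟩ := hTnull ha ha0
        have h1 := hTcomm a a₀
        rw [hκ, hκ', dotProduct_comm] at h1
        have h3 : κ' = κ := smul_right_injective _ ha' h1
        rw [hS, hTcomm, hκ', h3, dotProduct_comm]) u
    rw [hTcomm, (hS u).1 this, dotProduct_comm]
  have hκ0 : κ = 0 := by
    by_contra hκ0
    obtain ⟨u, hu⟩ := γ.surjective (γ 0 + κ)
    have hu0 : u ≠ 0 := by
      rintro rfl
      exact hκ0 (by simpa using hu)
    obtain ⟨y, hy⟩ := exists_dotProduct_eq_one hu0
    have h := hT u (-y)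
    rw [dotProduct_neg, hy] at h
    have h' : secondDiff γ 0 u (-y) = (-1 : F) • κ := h
    rw [secondDiff, zero_add, zero_add, hu, neg_smul, one_smul] at h'
    have h3 : γ (u + -y) = γ (-y) := by
      have : γ (u + -y) - γ (-y) - κ = -κ := by rw [← h']; abel
      rw [sub_eq_neg_self, sub_eq_zero] at this
      exact this
    exact hu0 (by simpa using γ.injective h3)
  exact (hT x y).trans (by rw [hκ0, smul_zero])

end DimensionAtLeastFour

section ConicCount

variable {F : Type*} [Field F] [Fintype F]

theorem sum_add_mul_sq_pow (h2 : (2 : F) ≠ 0) (a b : F) :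
    ∑ y : F, (a + b * y ^ 2) ^ (Fintype.card F / 2) = -b ^ (Fintype.card F / 2) := by
  classical
  have hcard : 2 * (Fintype.card F / 2) = Fintype.card F - 1 := by
    have := FiniteField.odd_card_of_char_ne_two (ringChar_ne_two h2)
    omega
  set h := Fintype.card F / 2
  have hpow : ∑ y : F, y ^ (2 * h) = -1 := by
    rw [hcard, ← Finset.sum_subset (Finset.subset_univ (Finset.univ.erase 0))]
    · rw [Finset.sum_congr rfl fun y hy =>
        FiniteField.pow_card_sub_one_eq_one y (Finset.ne_of_mem_erase hy)]
      simp [Finset.card_erase_of_mem, Nat.cast_sub Fintype.card_pos]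
    · intro y _ hy
      have hy0 : y = 0 := by simpa using hy
      have := Fintype.one_lt_card (α := F)
      rw [hy0, zero_pow (by omega)]
  calc ∑ y : F, (a + b * y ^ 2) ^ h
      = ∑ j ∈ Finset.range (h + 1), a ^ j * b ^ (h - j) * (h.choose j) *
          ∑ y : F, y ^ (2 * (h - j)) := by
        simp only [add_pow, Finset.mul_sum]
        rw [Finset.sum_comm]
        refine Finset.sum_congr rfl fun j _ => Finset.sum_congr rfl fun y _ => ?_
        rw [mul_pow, pow_mul]
        ring
    _ = -b ^ h := by
        rw [Finset.sum_eq_single_of_mem 0 (by simp)]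
        · simp [hpow]
        · intro j hj hj0
          rw [FiniteField.sum_pow_lt_card_sub_one, mul_zero]
          rw [Finset.mem_range] at hj
          omega

open scoped Classical in
theorem sum_ite_mul_sq_eq (h2 : (2 : F) ≠ 0) {b : F} (hb : b ≠ 0) (d : F) :
    ∑ y : F, (if b * y ^ 2 = d then (1 : F) else 0) = 1 + (d / b) ^ (Fintype.card F / 2) := by
  have h := congrArg (Int.cast (R := F)) (quadraticChar_card_sqrts (ringChar_ne_two h2) (d / b))
  push_cast at h
  rw [quadraticChar_eq_pow_of_char_ne_two' (ringChar_ne_two h2)] at h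
  rw [add_comm, ← h, Finset.sum_boole]
  congr 2
  ext y
  simp [eq_div_iff hb, mul_comm]

/-- In `F`, all the conics `a * y ^ 2 + b * z ^ 2 = c` have the same number of points. -/
theorem exists_sum_binary_form_eq (h2 : (2 : F) ≠ 0) {a b : F} (ha : a ≠ 0) (hb : b ≠ 0) :
    ∃ κ : F, κ ≠ 0 ∧ ∀ f : F → F, ∑ y : F, ∑ z : F, f (a * y ^ 2 + b * z ^ 2) = κ * ∑ c, f c := by
  classical
  refine ⟨-(-a / b) ^ (Fintype.card F / 2),
    neg_ne_zero.2 (pow_ne_zero _ (div_ne_zero (neg_ne_zero.2 ha) hb)), fun f => ?_⟩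
  have hN : ∀ c : F, ∑ y : F, ∑ z : F, (if b * z ^ 2 = c - a * y ^ 2 then (1 : F) else 0) =
      -(-a / b) ^ (Fintype.card F / 2) := by
    intro c
    simp only [sum_ite_mul_sq_eq h2 hb, Finset.sum_add_distrib, sum_const_eq_zero, zero_add]
    rw [← sum_add_mul_sq_pow h2 (c / b)]
    refine Finset.sum_congr rfl fun y _ => ?_
    congr 1
    ring
  have hf : ∀ y z : F, f (a * y ^ 2 + b * z ^ 2) =
      ∑ c, f c * (if b * z ^ 2 = c - a * y ^ 2 then (1 : F) else 0) := by
    intro y z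
    simp [eq_sub_iff_add_eq']
  calc ∑ y : F, ∑ z : F, f (a * y ^ 2 + b * z ^ 2)
      = ∑ c, f c * ∑ y : F, ∑ z : F, (if b * z ^ 2 = c - a * y ^ 2 then (1 : F) else 0) := by
        simp only [hf, Finset.mul_sum]
        exact (Finset.sum_congr rfl fun y _ => Finset.sum_comm).trans Finset.sum_comm
    _ = _ := by
        simp only [hN, ← Finset.sum_mul]
        rw [mul_comm]

end ConicCount

section DimensionThree

variable {F : Type*} [Field F]

theorem null_frame_independent {u v w : Fin 3 → F} (hu : u ⬝ᵥ u = 0) (hv : v ⬝ᵥ v = 0)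
    (huv : u ⬝ᵥ v ≠ 0) (huw : u ⬝ᵥ w = 0) (hvw : v ⬝ᵥ w = 0) (hw : w ⬝ᵥ w ≠ 0) (r s t : F)
    (h : r • u + s • v + t • w = 0) : r = 0 ∧ s = 0 ∧ t = 0 := by
  have h1 := congrArg (u ⬝ᵥ ·) h
  have h2 := congrArg (v ⬝ᵥ ·) h
  have h3 := congrArg (w ⬝ᵥ ·) h
  simp only [dotProduct_add, dotProduct_smul, hu, hv, huw, hvw, dotProduct_comm v u,
    dotProduct_comm w u, dotProduct_comm w v, smul_eq_mul, dotProduct_zero] at h1 h2 h3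
  simp_all

theorem orthogonal_frame_independent {u v w : Fin 3 → F} (hu : u ⬝ᵥ u ≠ 0) (hv : v ⬝ᵥ v ≠ 0)
    (huv : u ⬝ᵥ v = 0) (huw : u ⬝ᵥ w = 0) (hvw : v ⬝ᵥ w = 0) (hw : w ⬝ᵥ w ≠ 0) (r s t : F)
    (h : r • u + s • v + t • w = 0) : r = 0 ∧ s = 0 ∧ t = 0 := by
  have h1 := congrArg (u ⬝ᵥ ·) h
  have h2 := congrArg (v ⬝ᵥ ·) h
  have h3 := congrArg (w ⬝ᵥ ·) h
  simp only [dotProduct_add, dotProduct_smul, huv, huw, hvw, dotProduct_comm v u,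
    dotProduct_comm w u, dotProduct_comm w v, smul_eq_mul, dotProduct_zero] at h1 h2 h3
  simp_all

theorem exists_orthogonal_frame (h2 : (2 : F) ≠ 0) {u : Fin 3 → F} (hu : u ⬝ᵥ u ≠ 0) :
    ∃ v w : Fin 3 → F, v ⬝ᵥ v ≠ 0 ∧ w ⬝ᵥ w ≠ 0 ∧ u ⬝ᵥ v = 0 ∧ u ⬝ᵥ w = 0 ∧ v ⬝ᵥ w = 0 := by
  obtain ⟨i, hi⟩ : ∃ i, u i ^ 2 ≠ u ⬝ᵥ u := by
    by_contra! hall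
    have h3 : u ⬝ᵥ u = u 0 ^ 2 + u 1 ^ 2 + u 2 ^ 2 := by
      simp only [dotProduct, Fin.sum_univ_three]
      ring
    rw [hall, hall, hall] at h3
    exact mul_ne_zero h2 hu (by linear_combination -h3)
  let v : Fin 3 → F := Pi.single i (u ⬝ᵥ u) - u i • u
  have huv : u ⬝ᵥ v = 0 := by
    simp [v, dotProduct_sub, dotProduct_smul]
  have hv : v ⬝ᵥ v ≠ 0 := by
    have : v ⬝ᵥ v = (u ⬝ᵥ u) * (u ⬝ᵥ u - u i ^ 2) := by
      simp only [v, dotProduct_sub, sub_dotProduct, dotProduct_smul, smul_dotProduct,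
        dotProduct_single, single_dotProduct, Pi.sub_apply, Pi.smul_apply, Pi.single_eq_same,
        smul_eq_mul]
      ring
    rw [this]
    exact mul_ne_zero hu (sub_ne_zero.2 hi.symm)
  refine ⟨v, crossProduct u v, hv, ?_, huv, dot_self_cross _ _, dot_cross_self _ _⟩
  rw [cross_dot_cross, huv, dotProduct_comm v u, huv]
  simpa using ⟨hu, hv⟩

theorem existsUnique_null_line (h2 : (2 : F) ≠ 0) {m : Fin 3 → F} (hm : m ⬝ᵥ m = 0)
    (z : Fin 3 → F) : (∃! t : F, (z - t • m) ⬝ᵥ (z - t • m) = 0) ↔ m ⬝ᵥ z ≠ 0 := by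
  have key : ∀ t : F, (z - t • m) ⬝ᵥ (z - t • m) = z ⬝ᵥ z - t * (2 * (m ⬝ᵥ z)) := by
    intro t
    simp only [sub_dotProduct, dotProduct_sub, smul_dotProduct, dotProduct_smul, hm,
      dotProduct_comm z m, smul_eq_mul]
    ring
  simp only [key]
  constructor
  · rintro ⟨t, ht, huniq⟩ h0
    simp only [h0, mul_zero, sub_zero] at ht huniq
    exact zero_ne_one ((huniq 0 ht).trans (huniq 1 ht).symm)
  · intro h0
    have h0' : 2 * (m ⬝ᵥ z) ≠ 0 := mul_ne_zero h2 h0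
    refine ⟨z ⬝ᵥ z / (2 * (m ⬝ᵥ z)), by simp only [div_mul_cancel₀ _ h0', sub_self], fun t ht => ?_⟩
    rw [eq_div_iff h0']
    exact (sub_eq_zero.1 ht).symm

theorem secondDiff_congr_of_level_iff {V : Type*} [AddCommGroup V] {f : (Fin 3 → F) → V}
    {a x y x' y' : Fin 3 → F} (h : ∀ x y, f x = f y ↔ a ⬝ᵥ x = a ⬝ᵥ y) (hx : f x = f x')
    (hy : f y = f y') : secondDiff f 0 x y = secondDiff f 0 x' y' := by
  have hxy : f (x + y) = f (x' + y') := by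
    rw [h, dotProduct_add, dotProduct_add, (h _ _).1 hx, (h _ _).1 hy]
  simp only [secondDiff, zero_add, hx, hy, hxy]

variable [Fintype F]

theorem bijective_combination {u v w : Fin 3 → F}
    (h : ∀ r s t : F, r • u + s • v + t • w = 0 → r = 0 ∧ s = 0 ∧ t = 0) :
    Function.Bijective fun P : F × F × F => P.1 • u + P.2.1 • v + P.2.2 • w := by
  classical
  rw [Fintype.bijective_iff_injective_and_card]
  refine ⟨fun P Q hPQ => ?_, by simp [pow_succ, mul_assoc]⟩
  have := h (P.1 - Q.1) (P.2.1 - Q.2.1) (P.2.2 - Q.2.2) (by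
    rw [← sub_eq_zero.2 hPQ]
    module)
  simp only [sub_eq_zero] at this
  exact Prod.ext this.1 (Prod.ext this.2.1 this.2.2)

theorem sum_combination {M : Type*} [AddCommMonoid M] {u v w : Fin 3 → F}
    (h : ∀ r s t : F, r • u + s • v + t • w = 0 → r = 0 ∧ s = 0 ∧ t = 0) (f : (Fin 3 → F) → M) :
    ∑ z, f z = ∑ r : F, ∑ s : F, ∑ t : F, f (r • u + s • v + t • w) := by
  rw [← (bijective_combination h).sum_comp f]
  simp [Fintype.sum_prod_type]

/-- The number, in `F`, of points at nonsquare distance from both `x` and `y`. -/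
noncomputable def commonNonsquareCount (x y : Fin 3 → F) : F :=
  ∑ z, nonsquareInd ((z - x) ⬝ᵥ (z - x)) * nonsquareInd ((z - y) ⬝ᵥ (z - y))

theorem commonNonsquareCount_eq (x y : Fin 3 → F) : commonNonsquareCount x y =
    ∑ z, nonsquareInd (z ⬝ᵥ z) * nonsquareInd ((z - (y - x)) ⬝ᵥ (z - (y - x))) := by
  refine Fintype.sum_equiv (Equiv.subRight x) _ _ fun z => ?_
  simp

theorem IsIntegralPerm.commonNonsquareCount_apply {γ : (Fin 3 → F) ≃ (Fin 3 → F)}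
    (hγ : IsIntegralPerm γ) (x y : Fin 3 → F) :
    commonNonsquareCount (γ x) (γ y) = commonNonsquareCount x y :=
  (Fintype.sum_equiv γ _ _ fun z => by
    rw [nonsquareInd_congr (hγ z x), nonsquareInd_congr (hγ z y)]).symm

theorem commonNonsquareCount_eq_zero (h2 : (2 : F) ≠ 0) {x y : Fin 3 → F} (hxy : x ≠ y)
    (h : (y - x) ⬝ᵥ (y - x) = 0) : commonNonsquareCount x y = 0 := by
  rw [commonNonsquareCount_eq]
  set w := y - x with hw
  have hw0 : w ≠ 0 := sub_ne_zero.2 hxy.symm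
  obtain ⟨b, e, -, hb, hwb, hwe, hbe, he, -, -⟩ := exists_null_frame h2 (by simp) h hw0
  rw [sum_combination (null_frame_independent h hb hwb hwe hbe he), Finset.sum_comm]
  have hz : ∀ r s t : F, (r • w + s • b + t • e) ⬝ᵥ (r • w + s • b + t • e) =
      t ^ 2 * (e ⬝ᵥ e) + r * (2 * s * (w ⬝ᵥ b)) := by
    intro r s t
    simp only [add_dotProduct, dotProduct_add, smul_dotProduct, dotProduct_smul, smul_eq_mul, h,
      hb, hwe, hbe, dotProduct_comm e w, dotProduct_comm e b, dotProduct_comm b w]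
    ring
  have hz' : ∀ r s t : F, r • w + s • b + t • e - w = (r - 1) • w + s • b + t • e := fun r s t => by
    module
  simp only [hz', hz]
  refine Finset.sum_eq_zero fun s _ => ?_
  rw [Finset.sum_comm]
  rcases eq_or_ne s 0 with rfl | hs
  · simp
  · have hs0 : 2 * s * (w ⬝ᵥ b) ≠ 0 := mul_ne_zero (mul_ne_zero h2 hs) hwb
    have : ∀ t : F, ∑ r : F, nonsquareInd (t ^ 2 * (e ⬝ᵥ e) + r * (2 * s * (w ⬝ᵥ b))) *
        nonsquareInd (t ^ 2 * (e ⬝ᵥ e) + (r - 1) * (2 * s * (w ⬝ᵥ b))) =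
        ∑ c, nonsquareInd c * nonsquareInd (c - 2 * s * (w ⬝ᵥ b)) := by
      intro t
      rw [← sum_affine (fun c => nonsquareInd c * nonsquareInd (c - 2 * s * (w ⬝ᵥ b)))
        (t ^ 2 * (e ⬝ᵥ e)) hs0]
      refine Finset.sum_congr rfl fun r _ => ?_
      congr 2
      ring
    simp [this]

theorem commonNonsquareCount_ne_zero (h2 : (2 : F) ≠ 0) {x y : Fin 3 → F}
    (h : (y - x) ⬝ᵥ (y - x) ≠ 0) : commonNonsquareCount x y ≠ 0 := by
  rw [commonNonsquareCount_eq]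
  set w := y - x with hw
  obtain ⟨u, v, hu, hv, hwu, hwv, huv⟩ := exists_orthogonal_frame h2 h
  rw [sum_combination (orthogonal_frame_independent h hu hwu hwv huv hv)]
  have hz : ∀ r s t : F, (r • w + s • u + t • v) ⬝ᵥ (r • w + s • u + t • v) =
      r ^ 2 * (w ⬝ᵥ w) + ((u ⬝ᵥ u) * s ^ 2 + (v ⬝ᵥ v) * t ^ 2) := by
    intro r s t
    simp only [add_dotProduct, dotProduct_add, smul_dotProduct, dotProduct_smul, smul_eq_mul,
      hwu, hwv, huv, dotProduct_comm u w, dotProduct_comm v w, dotProduct_comm v u]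
    ring
  have hz' : ∀ r s t : F, r • w + s • u + t • v - w = (r - 1) • w + s • u + t • v := fun r s t => by
    module
  obtain ⟨κ, hκ, hsum⟩ := exists_sum_binary_form_eq h2 hu hv
  have key : ∀ r : F, ∑ c : F, nonsquareInd (r ^ 2 * (w ⬝ᵥ w) + c) *
      nonsquareInd ((r - 1) ^ 2 * (w ⬝ᵥ w) + c) =
      ∑ c, nonsquareInd c * nonsquareInd (c + w ⬝ᵥ w + r * (-2 * (w ⬝ᵥ w))) := by
    intro r
    refine Fintype.sum_equiv (Equiv.addLeft (r ^ 2 * (w ⬝ᵥ w))) _ _ fun c => ?_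
    simp only [Equiv.coe_addLeft]
    congr 2
    ring
  simp only [hz', hz]
  simp only [fun r : F => hsum fun c => nonsquareInd (r ^ 2 * (w ⬝ᵥ w) + c) *
      nonsquareInd ((r - 1) ^ 2 * (w ⬝ᵥ w) + c), key]
  rw [← Finset.mul_sum, Finset.sum_comm]
  simp only [← Finset.mul_sum, sum_affine nonsquareInd _ (mul_ne_zero (neg_ne_zero.2 h2) h)]
  rw [← Finset.sum_mul]
  exact mul_ne_zero hκ (mul_ne_zero (sum_nonsquareInd_ne_zero h2) (sum_nonsquareInd_ne_zero h2))

theorem IsIntegralPerm.null_iff (h2 : (2 : F) ≠ 0) {γ : (Fin 3 → F) ≃ (Fin 3 → F)}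
    (hγ : IsIntegralPerm γ) (x y : Fin 3 → F) :
    (x - y) ⬝ᵥ (x - y) = 0 ↔ (γ x - γ y) ⬝ᵥ (γ x - γ y) = 0 := by
  rcases eq_or_ne x y with rfl | hxy
  · simp
  have hzero : ∀ {x y : Fin 3 → F}, x ≠ y →
      ((x - y) ⬝ᵥ (x - y) = 0 ↔ commonNonsquareCount y x = 0) := fun hxy =>
    ⟨fun h => commonNonsquareCount_eq_zero h2 hxy.symm h, fun h => by
      by_contra h0
      exact commonNonsquareCount_ne_zero h2 h0 h⟩
  rw [hzero hxy, hzero (γ.injective.ne hxy), hγ.commonNonsquareCount_apply]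

theorem exists_eq_smul_of_null_perp (h2 : (2 : F) ≠ 0) {a v : Fin 3 → F} (ha : a ⬝ᵥ a = 0)
    (ha0 : a ≠ 0) (hv : v ⬝ᵥ v = 0) (hav : a ⬝ᵥ v = 0) : ∃ c : F, v = c • a := by
  obtain ⟨b, e, -, hb, hab, hae, hbe, he, -, -⟩ := exists_null_frame h2 (by simp) ha ha0
  obtain ⟨⟨r, s, t⟩, rfl⟩ :=
    (bijective_combination (null_frame_independent ha hb hab hae hbe he)).2 v
  have hs : s = 0 := by simpa [dotProduct_add, dotProduct_smul, ha, hae, hab] using hav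
  subst hs
  have ht : t = 0 := by
    simpa [dotProduct_add, add_dotProduct, smul_dotProduct, dotProduct_smul, ha, hae, he,
      dotProduct_comm e a] using hv
  exact ⟨r, by simp [ht]⟩

/-- The inverse image of a null line is a null line, so the inverse images of the planes tangent to
the null cone are planes of the same kind. -/
theorem IsIntegralPerm.exists_perp_iff (h2 : (2 : F) ≠ 0) {γ : (Fin 3 → F) ≃ (Fin 3 → F)}
    (hγ : IsIntegralPerm γ) {m : Fin 3 → F} (hm : m ⬝ᵥ m = 0) (hm0 : m ≠ 0) (x₀ : Fin 3 → F) :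
    ∃ a, a ≠ 0 ∧ ∀ x, m ⬝ᵥ γ x = m ⬝ᵥ γ x₀ ↔ a ⬝ᵥ x = a ⬝ᵥ x₀ := by
  let X : F → (Fin 3 → F) := fun t => γ.symm (γ x₀ + t • m)
  have hX : ∀ s t, (X s - X t) ⬝ᵥ (X s - X t) = 0 := by
    intro s t
    rw [hγ.null_iff h2]
    simp only [X, γ.apply_symm_apply, add_sub_add_left_eq_sub, ← sub_smul, smul_dotProduct,
      dotProduct_smul, hm, smul_zero]
  have hXinj : Function.Injective X := fun s t hst => by
    have := γ.symm.injective hst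
    exact smul_left_injective F hm0 (add_left_cancel this)
  have hX0 : X 0 = x₀ := by simp [X]
  let a := X 1 - X 0
  have ha : a ⬝ᵥ a = 0 := hX 1 0
  have ha0 : a ≠ 0 := sub_ne_zero.2 (hXinj.ne one_ne_zero)
  have hline : ∀ t, ∃ c : F, X t - X 0 = c • a := by
    intro t
    refine exists_eq_smul_of_null_perp h2 ha ha0 (hX t 0) ?_
    have h1 := hX t 1
    have h3 : X t - X 1 = (X t - X 0) - a := by simp [a]
    rw [h3, sub_dotProduct, dotProduct_sub (X t - X 0) (X t - X 0),
      dotProduct_sub a (X t - X 0), hX t 0, ha,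
      dotProduct_comm (X t - X 0)] at h1
    exact (mul_eq_zero.1 (by linear_combination -h1 : 2 * (a ⬝ᵥ (X t - X 0)) = 0)).resolve_left h2
  choose c hc using hline
  have hcbij : Function.Bijective c := Finite.injective_iff_bijective.1 fun s t hst => by
    apply hXinj
    rw [← sub_left_inj (a := X 0), hc, hc, hst]
  refine ⟨a, ha0, fun x => ?_⟩
  have h1 := existsUnique_null_line h2 hm (γ x - γ x₀)
  have h3 := existsUnique_null_line h2 ha (x - x₀)
  have h4 : ∀ t, ((γ x - γ x₀ - t • m) ⬝ᵥ (γ x - γ x₀ - t • m) = 0) ↔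
      ((x - x₀ - c t • a) ⬝ᵥ (x - x₀ - c t • a) = 0) := by
    intro t
    have := hγ.null_iff h2 x (X t)
    rw [← hc, hX0, sub_sub_sub_cancel_right, this]
    simp only [X, γ.apply_symm_apply, sub_sub]
  simp only [h4] at h1
  rw [hcbij.existsUnique_iff] at h3
  rw [dotProduct_sub, Ne, sub_eq_zero] at h1 h3
  exact not_iff_not.1 (h1.symm.trans h3)

theorem IsIntegralPerm.exists_level_iff (h2 : (2 : F) ≠ 0) {γ : (Fin 3 → F) ≃ (Fin 3 → F)}
    (hγ : IsIntegralPerm γ) {m : Fin 3 → F} (hm : m ⬝ᵥ m = 0) (hm0 : m ≠ 0) :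
    ∃ a : Fin 3 → F, ∀ x y, m ⬝ᵥ γ x = m ⬝ᵥ γ y ↔ a ⬝ᵥ x = a ⬝ᵥ y := by
  obtain ⟨a, -, ha⟩ := hγ.exists_perp_iff h2 hm hm0 0
  refine ⟨a, fun x y => ?_⟩
  obtain ⟨b, hb0, hb⟩ := hγ.exists_perp_iff h2 hm hm0 y
  rw [hb]
  obtain ⟨c, rfl⟩ : ∃ c : F, b = c • a := by
    by_contra! hcon
    obtain ⟨w, haw, hbw⟩ := exists_perp_dotProduct_ne_zero hcon
    simp only [dotProduct_zero] at ha
    have e1 : m ⬝ᵥ γ y = m ⬝ᵥ γ 0 := by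
      rw [← (ha (((b ⬝ᵥ y) / (b ⬝ᵥ w)) • w)).2 (by simp [dotProduct_smul, haw])]
      exact ((hb _).2 (by simp [dotProduct_smul, hbw])).symm
    have e2 : 0 = b ⬝ᵥ y := by simpa using (hb 0).1 e1.symm
    exact hbw (((hb w).1 (((ha w).2 haw).trans e1.symm)).trans e2.symm)
  have hc : c ≠ 0 := fun hc => hb0 (by simp [hc])
  simp [smul_dotProduct, hc]

theorem IsIntegralPerm.secondDiff_eq_zero_of_three (hp : (Fintype.card F).Prime)
    (h2 : (2 : F) ≠ 0) {γ : (Fin 3 → F) ≃ (Fin 3 → F)} (hγ : IsIntegralPerm γ)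
    (x y : Fin 3 → F) : secondDiff γ 0 x y = 0 := by
  obtain ⟨a₀, ha₀, ha₀0⟩ := exists_null_vector (F := F) hp le_rfl
  refine eq_zero_of_null_dotProduct h2 ha₀ ha₀0 fun m hm => ?_
  rcases eq_or_ne m 0 with rfl | hm0
  · exact zero_dotProduct _
  obtain ⟨l, e, c, hl, hml, hme, hle, he, -, hc⟩ := exists_null_frame h2 (by simp) hm hm0
  have hl0 : l ≠ 0 := fun h => hml (by simp [h])
  have hne : ∀ e, l ⬝ᵥ e = 0 → m + c • l + e ≠ 0 := fun e hle h => hml (by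
    simpa [dotProduct_add, dotProduct_smul, hl, hle, dotProduct_comm l m] using
      congrArg (l ⬝ᵥ ·) h)
  have hdiff : ∀ m x y, m ⬝ᵥ secondDiff γ 0 x y = secondDiff (fun z => m ⬝ᵥ γ z) 0 x y := by
    intro m x y
    simp [secondDiff, dotProduct_add, dotProduct_sub]
  have hdual : ∀ A B E : F, ∃ x, m ⬝ᵥ γ x = A ∧ l ⬝ᵥ γ x = B ∧ e ⬝ᵥ γ x = E := by
    intro A B E
    obtain ⟨x, hx⟩ := γ.surjective
      ((B / (m ⬝ᵥ l)) • m + (A / (m ⬝ᵥ l)) • l + (E / (e ⬝ᵥ e)) • e)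
    refine ⟨x, ?_, ?_, ?_⟩ <;>
    simp [hx, dotProduct_add, dotProduct_smul, hm, hl, hme, hle, hml, he, dotProduct_comm l m,
      dotProduct_comm e m, dotProduct_comm e l]
  have hzero : ∀ {m}, m ⬝ᵥ m = 0 → m ≠ 0 → ∀ x y,
      m ⬝ᵥ γ x = m ⬝ᵥ γ 0 ∨ m ⬝ᵥ γ y = m ⬝ᵥ γ 0 → m ⬝ᵥ secondDiff γ 0 x y = 0 := by
    intro m hm hm0 x y hxy
    obtain ⟨a, ha⟩ := hγ.exists_level_iff h2 hm hm0
    rw [hdiff]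
    rcases hxy with hx | hy
    · rw [secondDiff_congr_of_level_iff ha hx rfl, secondDiff_zero_left]
    · rw [secondDiff_congr_of_level_iff ha rfl hy, secondDiff_zero_right]
  obtain ⟨a, ha⟩ := hγ.exists_level_iff h2 hm hm0
  obtain ⟨x', hx1, hx2, hx3⟩ := hdual (m ⬝ᵥ γ x) (l ⬝ᵥ γ 0) (m ⬝ᵥ γ 0 + e ⬝ᵥ γ 0 - m ⬝ᵥ γ x)
  obtain ⟨y', hy1, hy2, hy4⟩ := hdual (m ⬝ᵥ γ y) (l ⬝ᵥ γ 0) (m ⬝ᵥ γ y - m ⬝ᵥ γ 0 + e ⬝ᵥ γ 0)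
  have h1 : m ⬝ᵥ secondDiff γ 0 x y = m ⬝ᵥ secondDiff γ 0 x' y' := by
    rw [hdiff, hdiff]
    exact secondDiff_congr_of_level_iff ha hx1.symm hy1.symm
  have hl' := hzero hl hl0 x' y' (Or.inl hx2)
  have h3 := hzero (null_frame_add hm hl hme hle hc) (hne e hle) x' y' (Or.inl (by
    simp only [add_dotProduct, smul_dotProduct, hx1, hx2, hx3, smul_eq_mul]
    ring))
  have h4 := hzero (null_frame_add (e := -e) hm hl (by simp [hme]) (by simp [hle])
    (by simpa using hc))
    (hne (-e) (by simp [hle])) x' y' (Or.inr (by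
      simp only [add_dotProduct, smul_dotProduct, neg_dotProduct, hy1, hy2, hy4, smul_eq_mul]
      ring))
  simp only [add_dotProduct, smul_dotProduct, neg_dotProduct, hl', smul_zero, add_zero] at h3 h4
  rw [h1]
  exact (mul_eq_zero.1 (by linear_combination h3 + h4 :
    2 * (m ⬝ᵥ secondDiff γ 0 x' y') = 0)).resolve_left h2

end DimensionThree

theorem IsIntegralPerm.exists_affine {F : Type*} [Field F] [Fintype F]
    (hp : (Fintype.card F).Prime) (h2 : (2 : F) ≠ 0) {n : ℕ} (hn : 3 ≤ n)
    {γ : (Fin n → F) ≃ (Fin n → F)} (hγ : IsIntegralPerm γ) :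
    ∃ (L : (Fin n → F) →ₗ[F] (Fin n → F)) (b : Fin n → F),
      Function.Bijective L ∧ ∀ x, γ x = L x + b := by
  refine exists_affine_of_secondDiff_eq_zero hp γ fun x y => ?_
  rcases hn.eq_or_lt with rfl | hn
  · exact hγ.secondDiff_eq_zero_of_three hp h2 x y
  · exact hγ.secondDiff_eq_zero_of_four_le hp h2 hn x y

/-- Let `p` be an odd prime, `n ≥ 3`, and `q = p` (so
`h = 1`). Every integral automorphism `γ` of `𝔽_p^n` is an affine
transformation: there are an invertible `𝔽_p`-linear map `L` and `b ∈ 𝔽_p^n`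
with `γ(x) = L(x) + b`. -/
theorem integral_automorphism_prime_field_affine
    (p n : ℕ) (hp : p.Prime) (hodd : Odd p) (hn : 3 ≤ n)
    (F : Type) [Field F] [Fintype F] (hF : Fintype.card F = p)
    (γ : (Fin n → F) → (Fin n → F)) (hγ : Function.Bijective γ)
    (hint : ∀ x y : Fin n → F,
      IsSquare (∑ j, (x j - y j) ^ 2) ↔ IsSquare (∑ j, (γ x j - γ y j) ^ 2)) :
    ∃ (L : (Fin n → F) →ₗ[F] (Fin n → F)) (b : Fin n → F),
      Function.Bijective L ∧ ∀ x : Fin n → F, γ x = L x + b := by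
  subst hF
  have h2 : (2 : F) ≠ 0 := by
    have := Fact.mk hp
    have := charP_of_card_eq_prime (R := F) (p := Fintype.card F) rfl
    intro h
    have hdvd := (CharP.cast_eq_zero_iff F (Fintype.card F) 2).1 (by exact_mod_cast h)
    rw [(Nat.prime_dvd_prime_iff_eq hp Nat.prime_two).1 hdvd] at hodd
    exact absurd hodd (by decide)
  have hγ' : IsIntegralPerm (Equiv.ofBijective γ hγ) := fun x y => by
    simpa only [dotProduct, Pi.sub_apply, ← sq, Equiv.ofBijective_apply] using hint x y
  exact hγ'.exists_affine hp h2 hn
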